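/- Let Ω_ε be the dumbbell family with λ₁(Ω₁) < λ₁(Ω₂), and let ε_i ↓ 0. For each i let φ_{1,ε_i} be a positive L²-normalized first Dirichlet eigenfunction of Ω_{ε_i}, extended by zero to ℝⁿ, and let φ_{1,0} be the zero-extension to ℝⁿ of the positive L²-normalized first Dirichlet eigenfunction φ₁^{Ω₁} of Ω₁. Assume the eigenvalue convergence λ₁(Ω_{ε_i}) → λ₁(Ω₁) and the L²-localization ‖φ_{1,ε_i} − φ_{1,0}‖_{L²(ℝⁿ)} → 0 as i → ∞. Then sup_{x ∈ Ω₁} |φ_{1,ε_i}(x) − φ_{1,0}(x)| → 0 as i → ∞. -/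

import Mathlib

open Set MeasureTheory Metric Filter

noncomputable section

abbrev ESp (k : ℕ) : Type := EuclideanSpace ℝ (Fin k)

/-- The Laplacian of a real-valued function on Euclidean space,
as the sum of the second derivatives along the coordinate directions. -/
def lap {k : ℕ} (f : ESp k → ℝ) (x : ESp k) : ℝ :=
  ∑ i : Fin k, fderiv ℝ (fun y => fderiv ℝ f y (EuclideanSpace.single i 1)) x
      (EuclideanSpace.single i 1)

/-- First Dirichlet eigenvalue as the infimum of the Rayleigh quotient over
nonzero smooth compactly supported test functions. -/
def dirEig1 {k : ℕ} (U : Set (ESp k)) : ℝ :=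
  sInf { r : ℝ | ∃ u : ESp k → ℝ, ContDiff ℝ (⊤ : ℕ∞) u ∧ HasCompactSupport u ∧
    tsupport u ⊆ U ∧ u ≠ 0 ∧
    r = (∫ x in U, ‖fderiv ℝ u x‖ ^ 2) / (∫ x in U, u x ^ 2) }

/-- A first Dirichlet eigenfunction of `U`. -/
def IsFirstDirEigenfun {k : ℕ} (U : Set (ESp k)) (φ : ESp k → ℝ) : Prop :=
  (∃ x ∈ U, φ x ≠ 0) ∧ ContDiffOn ℝ 2 φ U ∧ ContinuousOn φ (closure U) ∧
  (∀ x ∈ U, lap φ x + dirEig1 U * φ x = 0) ∧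
  (∀ x ∈ frontier U, φ x = 0)

/-- A set has smooth boundary: it is the sublevel set of a smooth defining
function with nonvanishing differential on the boundary. -/
def HasSmoothBoundary {k : ℕ} (Ω : Set (ESp k)) : Prop :=
  ∃ f : ESp k → ℝ, ContDiff ℝ (⊤ : ℕ∞) f ∧ Ω = f ⁻¹' (Iio 0) ∧
    ∀ x ∈ frontier Ω, fderiv ℝ f x ≠ 0

/-- The Euclidean norm `|x'|` of the last `m+1` coordinates of `x ∈ ℝ^(m+2)`. -/
def primeNorm {m : ℕ} (x : ESp (m + 2)) : ℝ :=
  Real.sqrt (∑ i : Fin (m + 1), x i.succ ^ 2)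

/-- The data of the dumbbell construction: two bounded disjoint open base domains
`Ω₁, Ω₂ ⊂ ℝ^(m+2)` with smooth boundary and flat boundary portions at `x₁ = -1`
(resp. `x₁ = 1`), and a smooth bump profile `ρ`. -/
structure Dumbbell (m : ℕ) where
  Ω₁ : Set (ESp (m + 2))
  Ω₂ : Set (ESp (m + 2))
  ξ : ℝ
  ρ : ℝ → ℝ
  hξ : 0 < ξ
  open₁ : IsOpen Ω₁
  open₂ : IsOpen Ω₂
  bounded₁ : Bornology.IsBounded Ω₁
  bounded₂ : Bornology.IsBounded Ω₂
  disj : Disjoint Ω₁ Ω₂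
  smooth₁ : HasSmoothBoundary Ω₁
  smooth₂ : HasSmoothBoundary Ω₂
  flat₁ : closure Ω₁ ∩ {x | -1 ≤ x 0 ∧ primeNorm x < 3 * ξ}
        = {x | x 0 = -1 ∧ primeNorm x < 3 * ξ}
  flat₁' : {x : ESp (m + 2) | x 0 = -1 ∧ primeNorm x < 3 * ξ} ⊆ frontier Ω₁
  flat₂ : closure Ω₂ ∩ {x | x 0 ≤ 1 ∧ primeNorm x < 3 * ξ}
        = {x | x 0 = 1 ∧ primeNorm x < 3 * ξ}
  flat₂' : {x : ESp (m + 2) | x 0 = 1 ∧ primeNorm x < 3 * ξ} ⊆ frontier Ω₂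
  ρ_pos : ∀ q ∈ Set.Ioc (-2 : ℝ) 0, 0 < ρ q
  ρ_smooth : ContDiffOn ℝ (⊤ : ℕ∞) ρ (Set.Ioo (-2 : ℝ) 0)
  ρ_cont : ContinuousOn ρ (Set.Ioc (-2 : ℝ) 0)
  ρ_zero : ρ 0 = 2
  ρ_one : ∀ q ∈ Set.Ioo (-2 : ℝ) (-1 : ℝ), ρ q = 1

namespace Dumbbell

variable {m : ℕ} (d : Dumbbell m)

def Q1 (ε : ℝ) : Set (ESp (m + 2)) :=
  {x | -1 ≤ x 0 ∧ x 0 ≤ -1 + 2 * ε ∧ primeNorm x < ε * d.ρ ((-1 - x 0) / ε)}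

def Q2 (ε : ℝ) : Set (ESp (m + 2)) :=
  {x | 1 - 2 * ε ≤ x 0 ∧ x 0 ≤ 1 ∧ primeNorm x < ε * d.ρ ((x 0 - 1) / ε)}

def Lε (_d : Dumbbell m) (ε : ℝ) : Set (ESp (m + 2)) :=
  {x | -1 + 2 * ε ≤ x 0 ∧ x 0 ≤ 1 - 2 * ε ∧ primeNorm x < ε}

/-- The connector `Q_ε`. -/
def Q (ε : ℝ) : Set (ESp (m + 2)) := d.Q1 ε ∪ d.Lε ε ∪ d.Q2 ε

/-- The dumbbell domain `Ω_ε = Ω₁ ∪ Ω₂ ∪ Q_ε`. -/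
def Ωε (ε : ℝ) : Set (ESp (m + 2)) := d.Ω₁ ∪ d.Ω₂ ∪ d.Q ε

end Dumbbell

/-- The truncated paraboloid `(1 - |y|²)₊`, used as an averaging kernel. -/
def cap {k : ℕ} (y : ESp k) : ℝ := max (1 - ‖y‖ ^ 2) 0

lemma cap_nonneg {k : ℕ} (y : ESp k) : 0 ≤ cap y := le_max_right _ _

lemma cap_le_one {k : ℕ} (y : ESp k) : cap y ≤ 1 := by
  unfold cap
  exact max_le (by nlinarith [sq_nonneg ‖y‖]) zero_le_one

lemma cap_eq_zero {k : ℕ} {y : ESp k} (hy : y ∉ closedBall (0 : ESp k) 1) : cap y = 0 := by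
  have h : 1 < ‖y‖ := by simpa using hy
  exact max_eq_right (by nlinarith)

lemma continuous_cap {k : ℕ} : Continuous (cap : ESp k → ℝ) := by
  unfold cap
  fun_prop

lemma hasCompactSupport_cap {k : ℕ} : HasCompactSupport (cap : ESp k → ℝ) :=
  HasCompactSupport.intro (isCompact_closedBall 0 1) fun _ hy => cap_eq_zero hy

lemma integral_cap_pos {k : ℕ} : 0 < ∫ y : ESp k, cap y := by
  refine continuous_cap.integral_pos_of_hasCompactSupport_nonneg_nonzero hasCompactSupport_cap
    cap_nonneg (x := 0) ?_
  simp [cap]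

lemma hasDerivAt_posPart_pow (n : ℕ) (t : ℝ) :
    HasDerivAt (fun s : ℝ => max s 0 ^ (n + 2)) ((n + 2) * max t 0 ^ (n + 1)) t := by
  rcases lt_trichotomy t 0 with h | h | h
  · have h1 : (fun s : ℝ => max s 0 ^ (n + 2)) =ᶠ[nhds t] fun _ => 0 := by
      filter_upwards [eventually_lt_nhds h] with s hs
      simp [max_eq_right hs.le]
    simpa [max_eq_right h.le] using (hasDerivAt_const t (0 : ℝ)).congr_of_eventuallyEq h1
  · subst h
    rw [hasDerivAt_iff_isLittleO]
    have h1 : (fun s : ℝ => max s 0 ^ (n + 2)) =o[nhds 0] fun s : ℝ => s := by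
      have h2 : (fun s : ℝ => max s 0 ^ (n + 2)) =O[nhds 0] fun s : ℝ => s ^ (n + 2) := by
        refine Asymptotics.IsBigO.of_bound 1 (Eventually.of_forall fun s => ?_)
        rw [one_mul, norm_pow, norm_pow]
        gcongr
        rw [Real.norm_eq_abs, Real.norm_eq_abs, abs_of_nonneg (le_max_right _ _)]
        exact max_le (le_abs_self s) (abs_nonneg s)
      refine h2.trans_isLittleO ?_
      simpa using Asymptotics.isLittleO_pow_pow (𝕜 := ℝ) (show 1 < n + 2 by omega)
    simpa using h1
  · have h1 : (fun s : ℝ => max s 0 ^ (n + 2)) =ᶠ[nhds t] fun s => s ^ (n + 2) := by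
      filter_upwards [eventually_gt_nhds h] with s hs
      simp [max_eq_left hs.le]
    simpa [max_eq_left h.le] using (hasDerivAt_pow (n + 2) t).congr_of_eventuallyEq h1

lemma contDiff_posPart_cube : ContDiff ℝ 2 (fun s : ℝ => max s 0 ^ 3) := by
  have h3 : deriv (fun s : ℝ => max s 0 ^ 3) = fun s => 3 * max s 0 ^ 2 := by
    ext t
    rw [(hasDerivAt_posPart_pow 1 t).deriv]
    norm_num
  have h2 : deriv (fun s : ℝ => 3 * max s 0 ^ 2) = fun s => 6 * max s 0 := by
    ext t
    rw [((hasDerivAt_posPart_pow 0 t).const_mul 3).deriv]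
    norm_num
    ring
  rw [show (2 : WithTop ℕ∞) = 1 + 1 by norm_num, contDiff_succ_iff_deriv, h3, contDiff_one_iff_deriv,
    h2]
  refine ⟨fun t => (hasDerivAt_posPart_pow 1 t).differentiableAt, by simp, fun t => ?_, by fun_prop⟩
  exact ((hasDerivAt_posPart_pow 0 t).const_mul 3).differentiableAt

lemma hasFDerivAt_cap_sq {k : ℕ} (y : ESp k) :
    HasFDerivAt (fun z : ESp k => cap z ^ 2 / 4) (-(cap y) • innerSL ℝ y) y := by
  have h1 : HasFDerivAt (fun z : ESp k => 1 - ‖z‖ ^ 2) (-(2 • innerSL ℝ y)) y := by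
    simpa using ((hasStrictFDerivAt_norm_sq y).hasFDerivAt).const_sub 1
  have h2 := (((hasDerivAt_posPart_pow 0 (1 - ‖y‖ ^ 2)).div_const 4).comp_hasFDerivAt y h1)
  refine h2.congr_fderiv ?_
  ext v
  simp [cap]
  ring

lemma integrable_mul_of_eq_zero_off_ball {k : ℕ} {f h : ESp k → ℝ} (hf : Continuous f)
    (hh : Continuous h) (h0 : ∀ y ∉ closedBall (0 : ESp k) 1, h y = 0) :
    Integrable fun y => f y * h y := by
  refine (hf.mul hh).integrable_of_hasCompactSupport ?_
  exact HasCompactSupport.intro (isCompact_closedBall 0 1) fun y hy => by simp [h0 y hy]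

lemma hasDerivAt_average {k : ℕ} {g : ESp k → ℝ} (hg : ContDiff ℝ 1 g) (x : ESp k) (r : ℝ) :
    HasDerivAt (fun s : ℝ => ∫ y, g (x + s • y) * cap y)
      (∫ y, fderiv ℝ g (x + r • y) y * cap y) r := by
  have hg' : Continuous (fderiv ℝ g) := hg.continuous_fderiv one_ne_zero
  have hgc := hg.continuous
  have hcap := continuous_cap (k := k)
  obtain ⟨C, hC⟩ := (isCompact_closedBall x (|r| + 1)).exists_bound_of_continuousOn
    hg'.continuousOn
  refine (hasDerivAt_integral_of_dominated_loc_of_deriv_le (s := ball r 1)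
    (F' := fun s y => fderiv ℝ g (x + s • y) y * cap y)
    (bound := fun y => C * cap y) (ball_mem_nhds r one_pos) ?_ ?_ ?_ ?_ ?_ ?_).2
  · refine Eventually.of_forall fun s => Continuous.aestronglyMeasurable ?_
    fun_prop
  · exact integrable_mul_of_eq_zero_off_ball (by fun_prop) hcap fun y hy => cap_eq_zero hy
  · refine Continuous.aestronglyMeasurable ?_
    fun_prop
  · refine Eventually.of_forall fun y s hs => ?_
    by_cases hy : y ∈ closedBall (0 : ESp k) 1
    · have hy1 : ‖y‖ ≤ 1 := by simpa using hy
      have hs1 : |s| ≤ |r| + 1 := by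
        have h1 : |s - r| < 1 := by simpa [Real.dist_eq] using hs
        have h2 := abs_sub_abs_le_abs_sub s r
        linarith
      have h1 : ‖fderiv ℝ g (x + s • y)‖ ≤ C := by
        refine hC _ ?_
        rw [mem_closedBall, dist_eq_norm, add_sub_cancel_left, norm_smul, Real.norm_eq_abs]
        nlinarith [abs_nonneg s, norm_nonneg y]
      rw [norm_mul, Real.norm_of_nonneg (cap_nonneg y)]
      refine mul_le_mul_of_nonneg_right ?_ (cap_nonneg y)
      calc ‖fderiv ℝ g (x + s • y) y‖ ≤ ‖fderiv ℝ g (x + s • y)‖ * ‖y‖ :=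
            ContinuousLinearMap.le_opNorm _ _
        _ ≤ C * 1 := by
            gcongr
            exact (norm_nonneg _).trans h1
        _ = C := mul_one C
    · simp [cap_eq_zero hy]
  · exact integrable_mul_of_eq_zero_off_ball continuous_const hcap fun y hy => cap_eq_zero hy
  · refine Eventually.of_forall fun y s _ => ?_
    have h1 : HasDerivAt (fun s : ℝ => x + s • y) y s := by
      simpa using ((hasDerivAt_id s).smul_const y).const_add x
    have h2 := ((hg.differentiable one_ne_zero) (x + s • y)).hasFDerivAt
    exact (h2.comp_hasDerivAt s h1).mul_const _

lemma integral_fderiv_mul_cap {k : ℕ} {g : ESp k → ℝ} (hg : ContDiff ℝ 2 g) (x : ESp k) (r : ℝ) :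
    ∫ y, fderiv ℝ g (x + r • y) y * cap y = r * ∫ y, lap g (x + r • y) * (cap y ^ 2 / 4) := by
  have hcap := continuous_cap (k := k)
  have hD : ContDiff ℝ 1 (fderiv ℝ g) := hg.fderiv_right (by norm_num)
  have hDi (i : Fin k) : ContDiff ℝ 1 fun z => fderiv ℝ g z (EuclideanSpace.single i 1) :=
    hD.clm_apply contDiff_const
  have hDc : Continuous (fderiv ℝ g) := hD.continuous
  have hDDc (i : Fin k) :
      Continuous (fderiv ℝ fun z => fderiv ℝ g z (EuclideanSpace.single i 1)) :=
    (hDi i).continuous_fderiv one_ne_zero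
  have hsq0 (y : ESp k) (hy : y ∉ closedBall (0 : ESp k) 1) : cap y ^ 2 / 4 = 0 := by
    simp [cap_eq_zero hy]
  have hparts (i : Fin k) :
      ∫ y : ESp k, fderiv ℝ g (x + r • y) (EuclideanSpace.single i 1) * (cap y * y i) =
        ∫ y, r * (fderiv ℝ (fun z => fderiv ℝ g z (EuclideanSpace.single i 1)) (x + r • y)
          (EuclideanSpace.single i 1) * (cap y ^ 2 / 4)) := by
    have hder (y : ESp k) : HasFDerivAt
        (fun y => fderiv ℝ g (x + r • y) (EuclideanSpace.single i 1))
        (r • fderiv ℝ (fun z => fderiv ℝ g z (EuclideanSpace.single i 1)) (x + r • y)) y := by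
      have h1 : HasFDerivAt (fun y : ESp k => x + r • y) (r • ContinuousLinearMap.id ℝ (ESp k)) y :=
        ((hasFDerivAt_id y).const_smul r).const_add x
      have h2 := (((hDi i).differentiable one_ne_zero) (x + r • y)).hasFDerivAt.comp y h1
      refine h2.congr_fderiv ?_
      ext v
      simp
    have hker (y : ESp k) : fderiv ℝ (fun z : ESp k => cap z ^ 2 / 4) y
        (EuclideanSpace.single i 1) = -(cap y * y i) := by
      rw [(hasFDerivAt_cap_sq y).fderiv]
      simp [EuclideanSpace.inner_single_right]
    have key := integral_mul_fderiv_eq_neg_fderiv_mul_of_integrable (μ := (volume : Measure (ESp k)))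
      (f := fun y => fderiv ℝ g (x + r • y) (EuclideanSpace.single i 1))
      (g := fun y => cap y ^ 2 / 4) (v := EuclideanSpace.single i 1) ?_ ?_ ?_
      (fun y _ => (hder y).differentiableAt) (fun y _ => (hasFDerivAt_cap_sq y).differentiableAt)
    · simp only [hker, (hder _).fderiv, mul_neg, integral_neg, neg_inj] at key
      rw [key]
      congr 1
      ext y
      simp
      ring
    · simp only [(hder _).fderiv]
      have := hDDc i
      exact integrable_mul_of_eq_zero_off_ball (by fun_prop) (by fun_prop) hsq0
    · simp only [hker]
      exact integrable_mul_of_eq_zero_off_ball (by fun_prop) (by fun_prop)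
        fun y hy => by simp [cap_eq_zero hy]
    · exact integrable_mul_of_eq_zero_off_ball (by fun_prop) (by fun_prop) hsq0
  have hexp (y : ESp k) : fderiv ℝ g (x + r • y) y * cap y =
      ∑ i, fderiv ℝ g (x + r • y) (EuclideanSpace.single i 1) * (cap y * y i) := by
    have h : fderiv ℝ g (x + r • y) y = fderiv ℝ g (x + r • y)
        (∑ i, (EuclideanSpace.basisFun (Fin k) ℝ).repr y i • EuclideanSpace.basisFun (Fin k) ℝ i) :=
      by rw [(EuclideanSpace.basisFun (Fin k) ℝ).sum_repr y]
    rw [h, map_sum, Finset.sum_mul]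
    refine Finset.sum_congr rfl fun i _ => ?_
    simp
    ring
  simp only [hexp]
  rw [integral_finsetSum, Finset.sum_congr rfl fun i _ => hparts i, ← integral_finsetSum,
    ← integral_const_mul]
  · congr 1
    ext y
    rw [← Finset.mul_sum, ← Finset.sum_mul]
    rfl
  · intro i _
    have := hDDc i
    exact (integrable_mul_of_eq_zero_off_ball (by fun_prop) (by fun_prop) hsq0).const_mul r
  · intro i _
    exact integrable_mul_of_eq_zero_off_ball (by fun_prop) (by fun_prop)
      fun y hy => by simp [cap_eq_zero hy]

/-- Mean value inequality for a `C²` function whose Laplacian is bounded below. -/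
lemma mul_integral_cap_le {k : ℕ} {g : ESp k → ℝ} (hg : ContDiff ℝ 2 g) {K : ℝ}
    (hK : ∀ z, -K ≤ lap g z) (x : ESp k) {R : ℝ} (hR : 0 ≤ R) :
    g x * ∫ y : ESp k, cap y ≤
      (∫ y, g (x + R • y) * cap y) + R ^ 2 / 2 * K * ∫ y : ESp k, cap y ^ 2 / 4 := by
  have hcap := continuous_cap (k := k)
  set J := ∫ y : ESp k, cap y ^ 2 / 4
  have hsq0 (y : ESp k) (hy : y ∉ closedBall (0 : ESp k) 1) : cap y ^ 2 / 4 = 0 := by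
    simp [cap_eq_zero hy]
  have hD : ContDiff ℝ 1 (fderiv ℝ g) := hg.fderiv_right (by norm_num)
  have hlap : Continuous (lap g) := by
    unfold lap
    refine continuous_finsetSum _ fun i _ => ?_
    have h1 : ContDiff ℝ 1 fun z => fderiv ℝ g z (EuclideanSpace.single i 1) :=
      hD.clm_apply contDiff_const
    exact (h1.continuous_fderiv one_ne_zero).clm_apply continuous_const
  let A : ℝ → ℝ := fun s => (∫ y, g (x + s • y) * cap y) + s ^ 2 / 2 * K * J
  have hA (s : ℝ) : HasDerivAt A
      (s * (∫ y, lap g (x + s • y) * (cap y ^ 2 / 4)) + s * K * J) s := by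
    have h1 := hasDerivAt_average (hg.of_le one_le_two) x s
    rw [integral_fderiv_mul_cap hg] at h1
    have h2 : HasDerivAt (fun s : ℝ => s ^ 2 / 2 * K * J) (s * K * J) s := by
      have := ((((hasDerivAt_pow 2 s).div_const 2).mul_const K).mul_const J)
      refine this.congr_deriv ?_
      norm_num
    exact h1.add h2
  have hmono : MonotoneOn A (Ici 0) := by
    refine monotoneOn_of_deriv_nonneg (convex_Ici 0)
      (fun s _ => (hA s).continuousAt.continuousWithinAt)
      (fun s _ => (hA s).differentiableAt.differentiableWithinAt) fun s hs => ?_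
    rw [interior_Ici] at hs
    rw [(hA s).deriv, mul_assoc, ← mul_add]
    refine mul_nonneg (le_of_lt hs) ?_
    have h1 : ∫ y : ESp k, -K * (cap y ^ 2 / 4) ≤ ∫ y, lap g (x + s • y) * (cap y ^ 2 / 4) := by
      refine integral_mono (integrable_mul_of_eq_zero_off_ball (by fun_prop) (by fun_prop) hsq0)
        (integrable_mul_of_eq_zero_off_ball (by fun_prop) (by fun_prop) hsq0) fun y => ?_
      exact mul_le_mul_of_nonneg_right (hK _) (by positivity)
    rw [integral_const_mul] at h1
    linarith
  have h := hmono (mem_Ici.2 le_rfl) (mem_Ici.2 hR) hR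
  simp only [A, zero_smul, add_zero, integral_const_mul] at h
  simpa using h

lemma lap_comp {k : ℕ} {F F' F'' : ℝ → ℝ} (hF : ∀ t, HasDerivAt F (F' t) t)
    (hF' : ∀ t, HasDerivAt F' (F'' t) t) {W : ESp k → ℝ} {z : ESp k} (hW : ContDiffAt ℝ 2 W z) :
    lap (fun y => F (W y)) z = F' (W z) * lap W z +
      F'' (W z) * ∑ i, fderiv ℝ W z (EuclideanSpace.single i 1) ^ 2 := by
  have hWd : ∀ᶠ y in nhds z, DifferentiableAt ℝ W y :=
    (hW.eventually (by simp)).mono fun y hy => hy.differentiableAt two_ne_zero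
  have hD : DifferentiableAt ℝ (fderiv ℝ W) z :=
    (hW.fderiv_right (m := 1) (by norm_num)).differentiableAt one_ne_zero
  unfold lap
  rw [Finset.mul_sum, Finset.mul_sum, ← Finset.sum_add_distrib]
  refine Finset.sum_congr rfl fun i _ => ?_
  have h1 : (fun y => fderiv ℝ (fun y => F (W y)) y (EuclideanSpace.single i 1)) =ᶠ[nhds z]
      fun y => F' (W y) * fderiv ℝ W y (EuclideanSpace.single i 1) := by
    filter_upwards [hWd] with y hy
    have h2 : HasFDerivAt (fun y => F (W y)) (F' (W y) • fderiv ℝ W y) y :=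
      (hF (W y)).comp_hasFDerivAt y hy.hasFDerivAt
    rw [h2.fderiv]
    rfl
  have h3 : HasFDerivAt (fun y => F' (W y)) (F'' (W z) • fderiv ℝ W z) z :=
    (hF' (W z)).comp_hasFDerivAt z hWd.self_of_nhds.hasFDerivAt
  have h4 : DifferentiableAt ℝ (fun y => fderiv ℝ W y (EuclideanSpace.single i 1)) z :=
    hD.clm_apply (differentiableAt_const _)
  rw [h1.fderiv_eq, (h3.fun_mul h4.hasFDerivAt).fderiv]
  simp
  ring

/-- Local boundedness of a subsolution: the cube of the positive part of `W` is controlled by an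
`L²` norm on a ball, provided `ΔW ≥ -K` on the set where `W` is positive. -/
lemma posPart_cube_le {k : ℕ} {W g : ESp k → ℝ} {M K R : ℝ} (hWc : Continuous W)
    (hWM : ∀ z, W z ≤ M) (hM : 0 ≤ M) (hK : 0 ≤ K) (hW2 : ∀ z, 0 < W z → ContDiffAt ℝ 2 W z)
    (hlap : ∀ z, 0 < W z → -K ≤ lap W z) (hg : Integrable fun z => g z ^ 2) (x : ESp k)
    (hR : 0 < R) (hWg : ∀ z ∈ closedBall x R, W z ≤ |g z|) :
    max (W x) 0 ^ 3 * ∫ y : ESp k, cap y ≤ M * ((R ^ k)⁻¹ * ∫ z, g z ^ 2) +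
      R ^ 2 / 2 * (3 * M ^ 2 * K) * ∫ y : ESp k, cap y ^ 2 / 4 := by
  have key (δ : ℝ) (hδ : 0 < δ) : max (W x - δ) 0 ^ 3 * ∫ y : ESp k, cap y ≤
      M * ((R ^ k)⁻¹ * ∫ z, g z ^ 2) +
        R ^ 2 / 2 * (3 * M ^ 2 * K) * ∫ y : ESp k, cap y ^ 2 / 4 := by
    let G : ESp k → ℝ := fun z => max (W z - δ) 0 ^ 3
    have hGzero (z : ESp k) (hz : W z ≤ 0) : G =ᶠ[nhds z] fun _ => 0 := by
      filter_upwards [hWc.continuousAt.eventually_lt_const (show W z < δ by linarith)] with y hy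
      simp [G, max_eq_right (show W y - δ ≤ 0 by linarith)]
    have hG2 : ContDiff ℝ 2 G := by
      refine contDiff_iff_contDiffAt.2 fun z => ?_
      rcases lt_or_ge 0 (W z) with hz | hz
      · exact contDiff_posPart_cube.contDiffAt.comp z ((hW2 z hz).sub contDiffAt_const)
      · exact contDiffAt_const.congr_of_eventuallyEq (hGzero z hz)
    have hF (t : ℝ) : HasDerivAt (fun s : ℝ => max (s - δ) 0 ^ 3) (3 * max (t - δ) 0 ^ 2) t := by
      refine ((hasDerivAt_posPart_pow 1 (t - δ)).comp_sub_const t δ).congr_deriv ?_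
      norm_num
    have hF' (t : ℝ) : HasDerivAt (fun s : ℝ => 3 * max (s - δ) 0 ^ 2) (6 * max (t - δ) 0) t := by
      refine (((hasDerivAt_posPart_pow 0 (t - δ)).comp_sub_const t δ).const_mul 3).congr_deriv ?_
      norm_num
      ring
    have hpos (z : ESp k) : 0 ≤ max (W z - δ) 0 := le_max_right _ _
    have hle (z : ESp k) : max (W z - δ) 0 ≤ M := max_le (by linarith [hWM z]) hM
    have hGlap (z : ESp k) : -(3 * M ^ 2 * K) ≤ lap G z := by
      rcases lt_or_ge 0 (W z) with hz | hz
      · rw [show lap G z = _ from lap_comp hF hF' (hW2 z hz)]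
        have h1 : 0 ≤ 6 * max (W z - δ) 0 *
            ∑ i, fderiv ℝ W z (EuclideanSpace.single i 1) ^ 2 :=
          mul_nonneg (by linarith [hpos z]) (Finset.sum_nonneg fun i _ => sq_nonneg _)
        have h2 : max (W z - δ) 0 ^ 2 ≤ M ^ 2 := pow_le_pow_left₀ (hpos z) (hle z) 2
        have h3 := mul_le_mul_of_nonneg_left (hlap z hz)
          (show 0 ≤ 3 * max (W z - δ) 0 ^ 2 by positivity)
        nlinarith
      · have h0 : lap G z = 0 := by
          unfold lap
          refine Finset.sum_eq_zero fun i _ => ?_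
          have h1 : (fun y => fderiv ℝ G y (EuclideanSpace.single i 1)) =ᶠ[nhds z] fun _ => 0 := by
            filter_upwards [(hGzero z hz).fderiv (𝕜 := ℝ)] with y hy
            simp [hy]
          simp [h1.fderiv_eq]
        rw [h0, neg_nonpos]
        positivity
    refine (mul_integral_cap_le hG2 hGlap x hR.le).trans (add_le_add_left ?_ _)
    have hscale : ∫ y, M * g (x + R • y) ^ 2 = M * ((R ^ k)⁻¹ * ∫ z, g z ^ 2) := by
      rw [integral_const_mul, Measure.integral_comp_smul volume (fun z => g (x + z) ^ 2) R,
        integral_add_left_eq_self (fun z => g z ^ 2) x]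
      simp [abs_of_pos hR]
    rw [← hscale]
    have hGc := hG2.continuous
    have hcap := continuous_cap (k := k)
    refine integral_mono (integrable_mul_of_eq_zero_off_ball (by fun_prop) hcap
      fun y hy => cap_eq_zero hy) ?_ fun y => ?_
    · exact ((hg.comp_add_left x).comp_smul hR.ne').const_mul M
    · by_cases hy : y ∈ closedBall (0 : ESp k) 1
      · have hy1 : ‖y‖ ≤ 1 := by simpa using hy
        have hmem : x + R • y ∈ closedBall x R := by
          rw [mem_closedBall, dist_eq_norm, add_sub_cancel_left, norm_smul, Real.norm_of_nonneg hR.le]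
          nlinarith
        have h1 : max (W (x + R • y) - δ) 0 ≤ |g (x + R • y)| :=
          max_le (by linarith [hWg _ hmem]) (abs_nonneg _)
        have h2 : max (W (x + R • y) - δ) 0 ^ 2 ≤ g (x + R • y) ^ 2 := by
          rw [← sq_abs (g _)]
          exact pow_le_pow_left₀ (hpos _) h1 2
        calc G (x + R • y) * cap y ≤ G (x + R • y) * 1 :=
              mul_le_mul_of_nonneg_left (cap_le_one y) (pow_nonneg (hpos _) 3)
          _ = max (W (x + R • y) - δ) 0 * max (W (x + R • y) - δ) 0 ^ 2 := by
              simp only [G]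
              ring
          _ ≤ M * g (x + R • y) ^ 2 := mul_le_mul (hle _) h2 (sq_nonneg _) hM
      · simp only [cap_eq_zero hy, mul_zero]
        positivity
  have hlim : Tendsto (fun δ : ℝ => max (W x - δ) 0 ^ 3 * ∫ y : ESp k, cap y) (nhdsWithin 0 (Ioi 0))
      (nhds (max (W x) 0 ^ 3 * ∫ y : ESp k, cap y)) := by
    have hc : Continuous fun δ : ℝ => max (W x - δ) 0 ^ 3 * ∫ y : ESp k, cap y := by fun_prop
    simpa using (hc.tendsto 0).mono_left nhdsWithin_le_nhds
  exact le_of_tendsto hlim (eventually_mem_nhdsWithin.mono fun δ hδ => key δ hδ)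

lemma exists_radius {a b R₁ : ℝ} (hb : 0 < b) (hR₁ : 0 < R₁) :
    ∃ R, 0 < R ∧ R ≤ R₁ ∧ R ^ 2 / 2 * a < b := by
  have hc : Continuous fun R : ℝ => R ^ 2 / 2 * a := by fun_prop
  have h : ∀ᶠ R in nhdsWithin (0 : ℝ) (Ioi 0), R ^ 2 / 2 * a < b :=
    ((hc.tendsto 0).mono_left nhdsWithin_le_nhds).eventually_lt_const (by simpa using hb)
  obtain ⟨R, h1, h2, h3⟩ := (h.and ((eventually_mem_nhdsWithin).and
    (Ioc_mem_nhdsGT hR₁))).exists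
  exact ⟨R, h2, h3.2, h1⟩

lemma exists_radius_eventually {k : ℕ} (M K : ℝ) {e R₁ : ℝ} (he : 0 < e) (hR₁ : 0 < R₁)
    {q : ℕ → ℝ} (hq : Tendsto q atTop (nhds 0)) :
    ∃ R, 0 < R ∧ R ≤ R₁ ∧ ∀ᶠ i in atTop, M * ((R ^ k)⁻¹ * q i) +
      R ^ 2 / 2 * (3 * M ^ 2 * K) * (∫ y : ESp k, cap y ^ 2 / 4) <
        e ^ 3 * ∫ y : ESp k, cap y := by
  have hI := integral_cap_pos (k := k)
  obtain ⟨R, h0, h1, h2⟩ := exists_radius (a := 3 * M ^ 2 * K * ∫ y : ESp k, cap y ^ 2 / 4)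
    (show 0 < e ^ 3 * ∫ y : ESp k, cap y by positivity) hR₁
  refine ⟨R, h0, h1, ?_⟩
  have hlim : Tendsto (fun i => M * ((R ^ k)⁻¹ * q i) +
      R ^ 2 / 2 * (3 * M ^ 2 * K) * (∫ y : ESp k, cap y ^ 2 / 4)) atTop
      (nhds (M * ((R ^ k)⁻¹ * 0) + R ^ 2 / 2 * (3 * M ^ 2 * K) * ∫ y : ESp k, cap y ^ 2 / 4)) :=
    ((hq.const_mul _).const_mul _).add_const _
  refine hlim.eventually_lt_const ?_
  linarith

lemma lt_of_posPart_cube_mul_lt {w e I : ℝ} (he : 0 ≤ e) (hI : 0 < I)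
    (h : max w 0 ^ 3 * I < e ^ 3 * I) : w < e :=
  (le_max_left w 0).trans_lt (lt_of_pow_lt_pow_left₀ 3 he (lt_of_mul_lt_mul_right h hI.le))

lemma integrable_sq {k : ℕ} {u : ESp k → ℝ} (hc : Continuous u) (hs : HasCompactSupport u) :
    Integrable fun x => u x ^ 2 := by
  refine (hc.pow 2).integrable_of_hasCompactSupport ?_
  exact HasCompactSupport.intro hs.isCompact fun x hx => by simp [image_eq_zero_of_notMem_tsupport hx]

/-- A uniform sup bound for `L²`-normalized nonnegative eigenfunctions with bounded eigenvalue,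
independent of the domain. -/
lemma exists_sup_bound (k : ℕ) (Λ : ℝ) : ∃ B : ℝ, 0 ≤ B ∧
    ∀ (u : ESp k → ℝ) (μ : ℝ), 0 ≤ μ → μ ≤ Λ → Continuous u → HasCompactSupport u →
      (∀ x, 0 ≤ u x) → (∀ x, 0 < u x → ContDiffAt ℝ 2 u x) →
      (∀ x, 0 < u x → lap u x + μ * u x = 0) → ∫ x, u x ^ 2 = 1 → ∀ x, u x ≤ B := by
  have hI := integral_cap_pos (k := k)
  set I := ∫ y : ESp k, cap y
  set J := ∫ y : ESp k, cap y ^ 2 / 4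
  have hJ0 : 0 ≤ J := integral_nonneg fun y => by positivity
  obtain ⟨R, hR, -, hRs⟩ := exists_radius (a := 3 * Λ * J) (half_pos hI) one_pos
  refine ⟨1 + 2 * (R ^ k)⁻¹ / I, by positivity, ?_⟩
  intro u μ hμ hμΛ huc husupp hu0 hu2 hulap hunorm x
  obtain ⟨x₀, hx₀⟩ := huc.exists_forall_ge_of_hasCompactSupport husupp
  refine (hx₀ x).trans ?_
  set M := u x₀
  have hM : 0 ≤ M := hu0 x₀
  have h := posPart_cube_le (g := u) (K := μ * M) huc hx₀ hM (by positivity) hu2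
    (fun z hz => by nlinarith [hulap z hz, mul_le_mul_of_nonneg_left (hx₀ z) hμ])
    (integrable_sq huc husupp) x₀ hR (fun z _ => le_abs_self _)
  rw [hunorm, max_eq_left hM, mul_one] at h
  have h1 : R ^ 2 / 2 * (3 * M ^ 2 * (μ * M)) * J ≤ M ^ 3 * (I / 2) := by
    calc R ^ 2 / 2 * (3 * M ^ 2 * (μ * M)) * J = M ^ 3 * (R ^ 2 / 2 * (3 * μ * J)) := by ring
      _ ≤ M ^ 3 * (R ^ 2 / 2 * (3 * Λ * J)) := by gcongr
      _ ≤ M ^ 3 * (I / 2) := by gcongr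
  rcases hM.eq_or_lt with h0 | h0
  · rw [← h0]
    positivity
  · have h2 : M ^ 2 * I ≤ 2 * (R ^ k)⁻¹ := by
      have : M * (M ^ 2 * I) ≤ M * (2 * (R ^ k)⁻¹) := by nlinarith
      exact le_of_mul_le_mul_left this h0
    have h3 : M ^ 2 ≤ 2 * (R ^ k)⁻¹ / I := by rwa [le_div_iff₀ hI]
    nlinarith [sq_nonneg (M - 1)]

lemma dirEig1_nonneg {k : ℕ} (U : Set (ESp k)) : 0 ≤ dirEig1 U := by
  refine Real.sInf_nonneg ?_
  rintro r ⟨u, -, -, -, -, rfl⟩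
  exact div_nonneg (integral_nonneg fun x => by positivity) (integral_nonneg fun x => sq_nonneg _)

lemma IsFirstDirEigenfun.isOpen {k : ℕ} {U : Set (ESp k)} {u : ESp k → ℝ}
    (hu : IsFirstDirEigenfun U u) (hpos : ∀ x ∈ U, 0 < u x) : IsOpen U := by
  rw [← disjoint_frontier_iff_isOpen, Set.disjoint_left]
  intro x hx hxU
  exact (hpos x hxU).ne' (hu.2.2.2.2 x hx)

lemma IsFirstDirEigenfun.continuous {k : ℕ} {U : Set (ESp k)} {u : ESp k → ℝ}
    (hu : IsFirstDirEigenfun U u) (hU : IsOpen U) (h0 : ∀ x ∉ U, u x = 0) : Continuous u := by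
  have h1 : ContinuousOn u Uᶜ := continuousOn_const.congr (f := fun _ => (0 : ℝ)) h0
  have h2 := hu.2.2.1.union_of_isClosed h1 isClosed_closure hU.isClosed_compl
  rw [← continuousOn_univ]
  refine h2.mono fun x _ => ?_
  by_cases hx : x ∈ U
  · exact .inl (subset_closure hx)
  · exact .inr hx

lemma hasCompactSupport_of_isBounded {k : ℕ} {U : Set (ESp k)} {u : ESp k → ℝ}
    (hU : Bornology.IsBounded U) (h0 : ∀ x ∉ U, u x = 0) : HasCompactSupport u :=
  HasCompactSupport.intro hU.isCompact_closure fun x hx => h0 x fun h => hx (subset_closure h)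

lemma isBounded_slab {m : ℕ} (a b c : ℝ) :
    Bornology.IsBounded {x : ESp (m + 2) | a ≤ x 0 ∧ x 0 ≤ b ∧ primeNorm x < c} := by
  refine (isBounded_closedBall (x := (0 : ESp (m + 2))) (r := |a| + |b| + |c|)).subset ?_
  rintro x ⟨h1, h2, h3⟩
  have h0 : |x 0| ≤ |a| + |b| :=
    abs_le.2 ⟨by linarith [neg_abs_le a, abs_nonneg b], by linarith [le_abs_self b, abs_nonneg a]⟩
  have hp : 0 ≤ primeNorm x := Real.sqrt_nonneg _
  have hp' : primeNorm x ^ 2 = ∑ i : Fin (m + 1), x i.succ ^ 2 :=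
    Real.sq_sqrt (Finset.sum_nonneg fun i _ => sq_nonneg _)
  have hn : ‖x‖ ^ 2 = |x 0| ^ 2 + primeNorm x ^ 2 := by
    rw [EuclideanSpace.real_norm_sq_eq, Fin.sum_univ_succ, hp', sq_abs]
  rw [mem_closedBall_zero_iff]
  have : ‖x‖ ≤ |x 0| + primeNorm x :=
    abs_le_of_sq_le_sq' (by nlinarith [mul_nonneg (abs_nonneg (x 0)) hp]) (by positivity) |>.2
  linarith [le_abs_self c]

namespace Dumbbell

variable {m : ℕ} (d : Dumbbell m)

lemma exists_ρ_le : ∃ C, ∀ q ∈ Icc (-2 : ℝ) 0, d.ρ q ≤ C := by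
  obtain ⟨C, hC⟩ := (isCompact_Icc (a := (-1 : ℝ)) (b := 0)).exists_bound_of_continuousOn
    (d.ρ_cont.mono fun q hq => ⟨by linarith [hq.1], hq.2⟩)
  refine ⟨max C (max 1 (d.ρ (-2))), fun q hq => ?_⟩
  rcases lt_or_ge q (-1) with h | h
  · rcases hq.1.eq_or_lt with h' | h'
    · subst h'
      exact (le_max_right _ _).trans (le_max_right _ _)
    · rw [d.ρ_one q ⟨h', h⟩]
      exact (le_max_left _ _).trans (le_max_right _ _)
  · exact ((le_abs_self _).trans (hC q ⟨h, hq.2⟩)).trans (le_max_left _ _)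

lemma isBounded_Ωε {ε : ℝ} (hε : 0 < ε) : Bornology.IsBounded (d.Ωε ε) := by
  obtain ⟨C, hC⟩ := d.exists_ρ_le
  have hQ1 : Bornology.IsBounded (d.Q1 ε) := by
    refine (isBounded_slab (-1) (-1 + 2 * ε) (ε * C)).subset ?_
    rintro x ⟨h1, h2, h3⟩
    refine ⟨h1, h2, h3.trans_le (mul_le_mul_of_nonneg_left (hC _ ⟨?_, ?_⟩) hε.le)⟩
    · rw [le_div_iff₀ hε]
      linarith
    · exact div_nonpos_of_nonpos_of_nonneg (by linarith) hε.le
  have hQ2 : Bornology.IsBounded (d.Q2 ε) := by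
    refine (isBounded_slab (1 - 2 * ε) 1 (ε * C)).subset ?_
    rintro x ⟨h1, h2, h3⟩
    refine ⟨h1, h2, h3.trans_le (mul_le_mul_of_nonneg_left (hC _ ⟨?_, ?_⟩) hε.le)⟩
    · rw [le_div_iff₀ hε]
      linarith
    · exact div_nonpos_of_nonpos_of_nonneg (by linarith) hε.le
  exact (d.bounded₁.union d.bounded₂).union ((hQ1.union (isBounded_slab _ _ _)).union hQ2)

end Dumbbell

lemma lap_sub_const {k : ℕ} (u : ESp k → ℝ) (c : ℝ) (x : ESp k) :
    lap (fun y => u y - c) x = lap u x := by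
  simp only [lap, fderiv_sub_const]

lemma lap_sub {k : ℕ} {u v : ESp k → ℝ} {x : ESp k} (hu : ContDiffAt ℝ 2 u x)
    (hv : ContDiffAt ℝ 2 v x) : lap (fun y => u y - v y) x = lap u x - lap v x := by
  have hd {f : ESp k → ℝ} (hf : ContDiffAt ℝ 2 f x) : ∀ᶠ y in nhds x, DifferentiableAt ℝ f y :=
    (hf.eventually (by simp)).mono fun y hy => hy.differentiableAt two_ne_zero
  have hD {f : ESp k → ℝ} (hf : ContDiffAt ℝ 2 f x) (e : ESp k) :
      DifferentiableAt ℝ (fun y => fderiv ℝ f y e) x :=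
    ((hf.fderiv_right (m := 1) (by norm_num)).differentiableAt one_ne_zero).clm_apply
      (differentiableAt_const _)
  unfold lap
  rw [← Finset.sum_sub_distrib]
  refine Finset.sum_congr rfl fun i _ => ?_
  have h1 : (fun y => fderiv ℝ (fun y => u y - v y) y (EuclideanSpace.single i 1)) =ᶠ[nhds x]
      fun y => fderiv ℝ u y (EuclideanSpace.single i 1) -
        fderiv ℝ v y (EuclideanSpace.single i 1) := by
    filter_upwards [hd hu, hd hv] with y hy hy'
    rw [fderiv_fun_sub hy hy']
    rfl
  rw [h1.fderiv_eq, fderiv_fun_sub (hD hu _) (hD hv _)]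
  rfl

/-- (Lemma 3.1.) Along a sequence `ε_i ↓ 0`, if the positive normalized
first Dirichlet eigenfunctions `φ_{1,ε_i}` of `Ω_{ε_i}` (extended by zero) converge in `L²(ℝⁿ)`
to the zero-extension `φ_{1,0}` of the first eigenfunction of `Ω₁` and the eigenvalues converge,
then `φ_{1,ε_i} → φ_{1,0}` uniformly on `Ω₁`. -/
theorem stmt2 (m : ℕ) (d : Dumbbell m)
    (hlam : dirEig1 d.Ω₁ < dirEig1 d.Ω₂)
    (ε : ℕ → ℝ) (hεpos : ∀ i, 0 < ε i) (hεanti : StrictAnti ε)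
    (hεlim : Tendsto ε atTop (nhds 0))
    (φ : ℕ → ESp (m + 2) → ℝ)
    (hφ : ∀ i, IsFirstDirEigenfun (d.Ωε (ε i)) (φ i))
    (hφpos : ∀ i, ∀ x ∈ d.Ωε (ε i), 0 < φ i x)
    (hφnorm : ∀ i, (∫ x in d.Ωε (ε i), (φ i x) ^ 2) = 1)
    (hφext : ∀ i, ∀ x, x ∉ d.Ωε (ε i) → φ i x = 0)
    (φ₀ : ESp (m + 2) → ℝ)
    (hφ₀ : IsFirstDirEigenfun d.Ω₁ φ₀)
    (hφ₀pos : ∀ x ∈ d.Ω₁, 0 < φ₀ x)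
    (hφ₀norm : (∫ x in d.Ω₁, φ₀ x ^ 2) = 1)
    (hφ₀ext : ∀ x, x ∉ d.Ω₁ → φ₀ x = 0)
    (heig : Tendsto (fun i => dirEig1 (d.Ωε (ε i))) atTop (nhds (dirEig1 d.Ω₁)))
    (hL2 : Tendsto (fun i => Real.sqrt (∫ x, (φ i x - φ₀ x) ^ 2)) atTop (nhds 0)) :
    Tendsto (fun i => sSup ((fun x => |φ i x - φ₀ x|) '' d.Ω₁)) atTop (nhds 0) := by
  have hpos0 {U : Set (ESp (m + 2))} {u : ESp (m + 2) → ℝ} (h : ∀ x ∈ U, 0 < u x)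
      (h' : ∀ x ∉ U, u x = 0) (x) : 0 ≤ u x := by
    by_cases hx : x ∈ U
    · exact (h x hx).le
    · exact (h' x hx).ge
  have hmem {U : Set (ESp (m + 2))} {u : ESp (m + 2) → ℝ} (h' : ∀ x ∉ U, u x = 0) {x}
      (hx : 0 < u x) : x ∈ U := by
    by_contra h
    exact hx.ne' (h' x h)
  have hopen i := (hφ i).isOpen (hφpos i)
  have hc i := (hφ i).continuous (hopen i) (hφext i)
  have hs i := hasCompactSupport_of_isBounded (d.isBounded_Ωε (hεpos i)) (hφext i)
  have hc₀ := hφ₀.continuous d.open₁ hφ₀ext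
  have hs₀ := hasCompactSupport_of_isBounded d.bounded₁ hφ₀ext
  have h0 i := hpos0 (hφpos i) (hφext i)
  have h0₀ := hpos0 hφ₀pos hφ₀ext
  have hC2 i x (hx : 0 < φ i x) : ContDiffAt ℝ 2 (φ i) x :=
    (hφ i).2.1.contDiffAt ((hopen i).mem_nhds (hmem (hφext i) hx))
  have hC2₀ x (hx : 0 < φ₀ x) : ContDiffAt ℝ 2 φ₀ x :=
    hφ₀.2.1.contDiffAt (d.open₁.mem_nhds (hmem hφ₀ext hx))
  obtain ⟨Λ, hΛ⟩ := heig.bddAbove_range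
  have hμΛ i : dirEig1 (d.Ωε (ε i)) ≤ Λ := hΛ (mem_range_self i)
  have hΛ0 : 0 ≤ Λ := (dirEig1_nonneg _).trans (hμΛ 0)
  obtain ⟨B, hB0, hB⟩ := exists_sup_bound (m + 2) Λ
  have hφB i x : φ i x ≤ B := by
    refine hB (φ i) _ (dirEig1_nonneg _) (hμΛ i) (hc i) (hs i) (h0 i) (hC2 i)
      (fun x hx => (hφ i).2.2.2.1 x (hmem (hφext i) hx)) ?_ x
    rw [← hφnorm i, setIntegral_eq_integral_of_forall_compl_eq_zero]
    intro x hx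
    simp [hφext i x hx]
  obtain ⟨B₀, hB₀⟩ : ∃ B₀, ∀ x, φ₀ x ≤ B₀ := by
    obtain ⟨x₀, hx₀⟩ := hc₀.exists_forall_ge_of_hasCompactSupport hs₀
    exact ⟨φ₀ x₀, hx₀⟩
  have hB₀0 : 0 ≤ B₀ := (h0₀ 0).trans (hB₀ 0)
  have hint i : Integrable fun x => (φ i x - φ₀ x) ^ 2 :=
    integrable_sq ((hc i).sub hc₀) ((hs i).sub hs₀)
  have hq : Tendsto (fun i => ∫ x, (φ i x - φ₀ x) ^ 2) atTop (nhds 0) := by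
    have h := hL2.pow 2
    simpa [Real.sq_sqrt (integral_nonneg fun x => sq_nonneg _)] using h
  have hI := integral_cap_pos (k := m + 2)
  have hupper (e : ℝ) (he : 0 < e) : ∀ᶠ i in atTop, ∀ x, φ i x - φ₀ x < 2 * e := by
    obtain ⟨R₁, hR₁, huc⟩ := Metric.uniformContinuous_iff_le.1
      (hs₀.uniformContinuous_of_continuous hc₀) e he
    obtain ⟨R, hR, hRR₁, hev⟩ := exists_radius_eventually (k := m + 2) B (Λ * B) he hR₁ hq
    filter_upwards [hev] with i hi x
    have h := posPart_cube_le (W := fun z => φ i z - (φ₀ x + e)) (g := fun z => φ i z - φ₀ z)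
      (M := B) (K := Λ * B) (R := R) ((hc i).sub continuous_const)
      (fun z => by linarith [hφB i z, h0₀ x]) hB0 (by positivity)
      (fun z hz => (hC2 i z (by linarith [h0₀ x])).sub contDiffAt_const)
      (fun z hz => ?_) (hint i) x hR (fun z hz => ?_)
    · have := lt_of_posPart_cube_mul_lt he.le hI (h.trans_lt hi)
      linarith
    · rw [lap_sub_const]
      have h1 := (hφ i).2.2.2.1 z (hmem (hφext i) (by linarith [h0₀ x]))
      have h2 : dirEig1 (d.Ωε (ε i)) * φ i z ≤ Λ * B :=
        mul_le_mul (hμΛ i) (hφB i z) (h0 i z) hΛ0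
      linarith
    · have h1 := huc ((mem_closedBall.1 hz).trans hRR₁)
      rw [Real.dist_eq] at h1
      exact le_trans (by linarith [le_abs_self (φ₀ z - φ₀ x)]) (le_abs_self _)
  have hlower (e : ℝ) (he : 0 < e) : ∀ᶠ i in atTop, ∀ x, φ₀ x - φ i x < e := by
    obtain ⟨R, hR, -, hev⟩ := exists_radius_eventually (k := m + 2) B₀ (dirEig1 d.Ω₁ * B₀) he
      one_pos hq
    have hμ₀ := dirEig1_nonneg d.Ω₁
    filter_upwards [hev] with i hi x
    have hz₀ {z} (hz : 0 < φ₀ z - φ i z) : 0 < φ₀ z := by linarith [h0 i z]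
    have hz₁ {z} (hz : 0 < φ₀ z - φ i z) : z ∈ d.Ωε (ε i) := .inl (.inl (hmem hφ₀ext (hz₀ hz)))
    have h := posPart_cube_le (W := fun z => φ₀ z - φ i z) (g := fun z => φ i z - φ₀ z)
      (M := B₀) (K := dirEig1 d.Ω₁ * B₀) (R := R) (hc₀.sub (hc i))
      (fun z => by linarith [hB₀ z, h0 i z]) hB₀0 (by positivity)
      (fun z hz => (hC2₀ z (hz₀ hz)).sub (hC2 i z (hφpos i z (hz₁ hz))))
      (fun z hz => ?_) (hint i) x hR (fun z _ => ?_)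
    · exact lt_of_posPart_cube_mul_lt he.le hI (h.trans_lt hi)
    · rw [lap_sub (hC2₀ z (hz₀ hz)) (hC2 i z (hφpos i z (hz₁ hz)))]
      have h1 := (hφ i).2.2.2.1 z (hz₁ hz)
      have h2 := hφ₀.2.2.2.1 z (hmem hφ₀ext (hz₀ hz))
      have h3 := mul_le_mul_of_nonneg_left (hB₀ z) hμ₀
      have h4 := mul_nonneg (dirEig1_nonneg (d.Ωε (ε i))) (h0 i z)
      linarith
    · rw [abs_sub_comm]
      exact le_abs_self _
  rw [Metric.tendsto_nhds]
  intro e he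
  obtain ⟨x₀, hx₀, -⟩ := hφ₀.1
  filter_upwards [hupper (e / 4) (by positivity), hlower (e / 2) (by positivity)] with i h1 h2
  have hsup : sSup ((fun x => |φ i x - φ₀ x|) '' d.Ω₁) ≤ e / 2 := by
    refine csSup_le (Set.Nonempty.image _ ⟨x₀, hx₀⟩) ?_
    rintro _ ⟨x, -, rfl⟩
    exact abs_le.2 ⟨by linarith [h2 x], by linarith [h1 x]⟩
  have hnn : 0 ≤ sSup ((fun x => |φ i x - φ₀ x|) '' d.Ω₁) := by
    refine Real.sSup_nonneg ?_
    rintro _ ⟨x, -, rfl⟩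
    exact abs_nonneg _
  rw [Real.dist_eq, sub_zero, abs_of_nonneg hnn]
  linarith
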